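/- Let Θ and 𝒴 be measurable spaces, κ a Markov kernel from Θ to 𝒴, and p, q probability measures on Θ with q absolutely continuous with respect to p. Then the affine approximation is an upper bound for the expected information gain: I(q) ≤ I_aff(q;p), i.e. ∫ KL(κ(θ) ‖ q∘κ) dq(θ) ≤ ∫ KL(κ(θ) ‖ p∘κ) dq(θ). -/

import Mathlib

open MeasureTheory ProbabilityTheory Real Classical
open scoped ENNReal

/-- The Kullback–Leibler divergence `KL(μ ‖ ν) = ∫ log (dμ/dν) dμ`, with value `∞`
unless `μ` is absolutely continuous w.r.t. `ν` and the log-likelihood ratio is integrable. -/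
noncomputable def klDiv {α : Type*} [MeasurableSpace α] (μ ν : Measure α) : ℝ≥0∞ :=
  if μ ≪ ν ∧ Integrable (llr μ ν) μ then ENNReal.ofReal (∫ x, llr μ ν x ∂μ) else ⊤

/-- The marginal `q∘κ` on `𝒴` of a prior `q` on `Θ` under the likelihood kernel `κ`,
given by `(q∘κ)(A) = ∫ κ(θ)(A) dq(θ)`. -/
noncomputable def marg {Θ 𝒴 : Type*} [MeasurableSpace Θ] [MeasurableSpace 𝒴]
    (κ : Kernel Θ 𝒴) (q : Measure Θ) : Measure 𝒴 :=
  q.bind κ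

/-- The expected information gain of prior `q`: `I(q) = ∫ KL(κ(θ) ‖ q∘κ) dq(θ)`. -/
noncomputable def EIG {Θ 𝒴 : Type*} [MeasurableSpace Θ] [MeasurableSpace 𝒴]
    (κ : Kernel Θ 𝒴) (q : Measure Θ) : ℝ≥0∞ :=
  ∫⁻ θ, klDiv (κ θ) (marg κ q) ∂q

/-- The affine approximation of the expected information gain at reference prior `p`:
`I_aff(q;p) = ∫ KL(κ(θ) ‖ p∘κ) dq(θ)`. -/
noncomputable def EIGaff {Θ 𝒴 : Type*} [MeasurableSpace Θ] [MeasurableSpace 𝒴]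
    (κ : Kernel Θ 𝒴) (q p : Measure Θ) : ℝ≥0∞ :=
  ∫⁻ θ, klDiv (κ θ) (marg κ p) ∂q

lemma one_sub_rnDeriv_le_llr {α : Type*} [MeasurableSpace α] (μ ν : Measure α)
    [SigmaFinite μ] [SigmaFinite ν] (h : μ ≪ ν) :
    ∀ᵐ x ∂μ, 1 - (ν.rnDeriv μ x).toReal ≤ llr μ ν x := by
  filter_upwards [Measure.inv_rnDeriv h, Measure.rnDeriv_pos h, h (Measure.rnDeriv_lt_top μ ν)]
    with x hx hpos hlt
  rw [Pi.inv_apply] at hx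
  have := Real.one_sub_inv_le_log_of_pos (ENNReal.toReal_pos hpos.ne' hlt.ne)
  rwa [← hx, ENNReal.toReal_inv]

lemma lintegral_ofReal_neg_llr_ne_top {α : Type*} [MeasurableSpace α] (μ ν : Measure α)
    [SigmaFinite μ] [IsFiniteMeasure ν] (h : μ ≪ ν) :
    ∫⁻ x, ENNReal.ofReal (-llr μ ν x) ∂μ ≠ ∞ := by
  refine ((lintegral_mono_ae ?_).trans_lt (Measure.lintegral_rnDeriv_lt_top ν μ)).ne
  filter_upwards [one_sub_rnDeriv_le_llr μ ν h] with x hx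
  exact (ENNReal.ofReal_le_ofReal (by linarith)).trans ENNReal.ofReal_toReal_le

lemma lintegral_ofReal_neg_llr_le {α : Type*} [MeasurableSpace α] (μ ν : Measure α)
    [IsProbabilityMeasure μ] [IsProbabilityMeasure ν] (h : μ ≪ ν) :
    ∫⁻ x, ENNReal.ofReal (-llr μ ν x) ∂μ ≤ ∫⁻ x, ENNReal.ofReal (llr μ ν x) ∂μ := by
  have key : ∫⁻ x, ENNReal.ofReal (-llr μ ν x) + 1 ∂μ
      ≤ ∫⁻ x, ENNReal.ofReal (llr μ ν x) + ν.rnDeriv μ x ∂μ := by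
    refine lintegral_mono_ae ?_
    filter_upwards [one_sub_rnDeriv_le_llr μ ν h] with x hx
    refine le_trans ?_ (add_le_add_right ENNReal.ofReal_toReal_le _)
    rw [← ENNReal.ofReal_one]
    rcases le_total 0 (llr μ ν x) with h0 | h0
    · rw [ENNReal.ofReal_of_nonpos (neg_nonpos.2 h0), zero_add,
        ← ENNReal.ofReal_add h0 ENNReal.toReal_nonneg]
      exact ENNReal.ofReal_le_ofReal (by linarith)
    · rw [ENNReal.ofReal_of_nonpos h0, zero_add,
        ← ENNReal.ofReal_add (neg_nonneg.2 h0) zero_le_one]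
      exact ENNReal.ofReal_le_ofReal (by linarith)
  rw [lintegral_add_right _ measurable_const, lintegral_const, measure_univ, mul_one,
    lintegral_add_right _ (Measure.measurable_rnDeriv ν μ)] at key
  refine (ENNReal.add_le_add_iff_right ENNReal.one_ne_top).1 (key.trans ?_)
  exact add_le_add_right ((Measure.lintegral_rnDeriv_le).trans measure_univ.le) _

lemma absolutelyContinuous_of_rnDeriv_ne_zero {α : Type*} [MeasurableSpace α]
    {ρ ν μ : Measure α} [SigmaFinite ν] [SigmaFinite μ] (hνμ : ν ≪ μ) (hρμ : ρ ≪ μ)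
    (hr : ∀ᵐ x ∂ρ, ν.rnDeriv μ x ≠ 0) : ρ ≪ ν := by
  refine Measure.AbsolutelyContinuous.mk fun s hs h0 ↦ ?_
  rw [← Measure.setLIntegral_rnDeriv hνμ, setLIntegral_eq_zero_iff hs
    (Measure.measurable_rnDeriv ν μ)] at h0
  refine measure_eq_zero_iff_ae_notMem.2 ?_
  filter_upwards [hr, hρμ h0] with x h1 h2 hx using h1 (h2 hx)

lemma llr_eq_add_llr {α : Type*} [MeasurableSpace α] {ρ ν μ : Measure α}
    [SigmaFinite ρ] [SigmaFinite ν] [SigmaFinite μ] (hρν : ρ ≪ ν) (hνμ : ν ≪ μ) :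
    ∀ᵐ x ∂ρ, llr ρ μ x = llr ρ ν x + llr ν μ x := by
  have hρμ := hρν.trans hνμ
  filter_upwards [hρμ (Measure.rnDeriv_mul_rnDeriv hρν (κ := μ)), Measure.rnDeriv_pos hρν,
    hρν (Measure.rnDeriv_lt_top ρ ν), hρν (Measure.rnDeriv_pos hνμ),
    hρμ (Measure.rnDeriv_lt_top ν μ)] with x hx h1 h2 h3 h4
  simp only [llr]
  rw [← hx, Pi.mul_apply, ENNReal.toReal_mul,
    Real.log_mul (ENNReal.toReal_pos h1.ne' h2.ne).ne' (ENNReal.toReal_pos h3.ne' h4.ne).ne']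

lemma integral_llr_nonneg {α : Type*} [MeasurableSpace α] {μ ν : Measure α}
    [IsProbabilityMeasure μ] [IsProbabilityMeasure ν] (h : μ ≪ ν)
    (hi : Integrable (llr μ ν) μ) : 0 ≤ ∫ x, llr μ ν x ∂μ := by
  simpa using InformationTheory.integral_llr_add_sub_measure_univ_nonneg h hi

/-- Change of reference measure in the Kullback–Leibler divergence. -/
lemma klDiv_add_lintegral_llr_le {α : Type*} [MeasurableSpace α] {ρ ν μ : Measure α}
    [IsProbabilityMeasure ρ] [IsProbabilityMeasure ν] [IsProbabilityMeasure μ]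
    (hνμ : ν ≪ μ) (hr : ∀ᵐ x ∂ρ, ν.rnDeriv μ x ≠ 0)
    (hneg : ∫⁻ x, ENNReal.ofReal (-llr ν μ x) ∂ρ ≠ ∞) :
    klDiv ρ ν + ∫⁻ x, ENNReal.ofReal (llr ν μ x) ∂ρ
      ≤ klDiv ρ μ + ∫⁻ x, ENNReal.ofReal (-llr ν μ x) ∂ρ := by
  by_cases hg : ρ ≪ μ ∧ Integrable (llr ρ μ) ρ
  swap
  · simp [klDiv, hg]
  obtain ⟨hρμ, hint⟩ := hg
  have hρν := absolutelyContinuous_of_rnDeriv_ne_zero hνμ hρμ hr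
  have hadd := llr_eq_add_llr hρν hνμ
  have hmeas : Measurable (llr ν μ) := measurable_llr ν μ
  have hint_neg : Integrable (fun x ↦ max (-llr ν μ x) 0) ρ := by
    simpa only [Pi.neg_apply, ENNReal.toReal_ofReal'] using
      integrable_toReal_of_lintegral_ne_top hmeas.neg.ennreal_ofReal.aemeasurable hneg
  have hintℓ : Integrable (llr ν μ) ρ := by
    refine ((hint.abs.add (Measure.integrable_toReal_rnDeriv (μ := ν) (ν := ρ))).add
      hint_neg).mono' hmeas.aestronglyMeasurable ?_
    filter_upwards [hadd, one_sub_rnDeriv_le_llr ρ ν hρν] with x h1 h2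
    have h3 := le_abs_self (llr ρ μ x)
    have h4 := abs_nonneg (llr ρ μ x)
    have h5 : 0 ≤ (ν.rnDeriv ρ x).toReal := ENNReal.toReal_nonneg
    have h6 := le_max_left (-llr ν μ x) 0
    have h7 := le_max_right (-llr ν μ x) 0
    simp only [Pi.add_apply, Real.norm_eq_abs]
    exact abs_le.2 ⟨by linarith, by linarith⟩
  have hintν : Integrable (llr ρ ν) ρ := by
    refine (hint.sub hintℓ).congr ?_
    filter_upwards [hadd] with x hx
    simp [hx]
  have hpos : ∫⁻ x, ENNReal.ofReal (llr ν μ x) ∂ρ ≠ ∞ := hintℓ.lintegral_lt_top.ne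
  have hsum : ∫ x, llr ρ μ x ∂ρ = ∫ x, llr ρ ν x ∂ρ + ∫ x, llr ν μ x ∂ρ := by
    rw [← integral_add hintν hintℓ, integral_congr_ae hadd]
  rw [integral_eq_lintegral_pos_part_sub_lintegral_neg_part hintℓ] at hsum
  have ha := integral_llr_nonneg hρν hintν
  have hb := integral_llr_nonneg hρμ hint
  simp only [klDiv, hρν, hintν, hρμ, hint, and_self, if_true]
  rw [← ENNReal.ofReal_toReal hpos, ← ENNReal.ofReal_toReal hneg,
    ← ENNReal.ofReal_add ha ENNReal.toReal_nonneg, ← ENNReal.ofReal_add hb ENNReal.toReal_nonneg]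
  exact ENNReal.ofReal_le_ofReal (by linarith)

/-- The affine approximation is an upper bound for the expected information gain:
`I(q) ≤ I_aff(q;p)`. -/
theorem eig_le_eigAff
    {Θ 𝒴 : Type*} [MeasurableSpace Θ] [MeasurableSpace 𝒴]
    (κ : Kernel Θ 𝒴) [IsMarkovKernel κ] (p q : Measure Θ)
    [IsProbabilityMeasure p] [IsProbabilityMeasure q] (hqp : q ≪ p) :
    EIG κ q ≤ EIGaff κ q p := by
  have : IsProbabilityMeasure (marg κ p) := inferInstanceAs (IsProbabilityMeasure (p.bind κ))
  have : IsProbabilityMeasure (marg κ q) := inferInstanceAs (IsProbabilityMeasure (q.bind κ))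
  have hac : marg κ q ≪ marg κ p := hqp.comp_right κ
  set ℓ := llr (marg κ q) (marg κ p)
  have hmeas : Measurable ℓ := measurable_llr _ _
  have hmeas_pos : Measurable fun y ↦ ENNReal.ofReal (ℓ y) := hmeas.ennreal_ofReal
  have hmeas_neg : Measurable fun y ↦ ENNReal.ofReal (-ℓ y) := hmeas.neg.ennreal_ofReal
  have hpos := Measure.lintegral_bind κ.aemeasurable (m := q) hmeas_pos.aemeasurable
  have hneg := Measure.lintegral_bind κ.aemeasurable (m := q) hmeas_neg.aemeasurable
  have hfin := lintegral_ofReal_neg_llr_ne_top _ _ hac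
  have hle := lintegral_ofReal_neg_llr_le _ _ hac
  change ∫⁻ y, ENNReal.ofReal (-ℓ y) ∂(q.bind κ) ≠ ∞ at hfin
  change ∫⁻ y, ENNReal.ofReal (-ℓ y) ∂(q.bind κ) ≤ ∫⁻ y, ENNReal.ofReal (ℓ y) ∂(q.bind κ) at hle
  rw [hneg] at hfin
  rw [hneg, hpos] at hle
  have hr : ∀ᵐ θ ∂q, ∀ᵐ y ∂(κ θ), (marg κ q).rnDeriv (marg κ p) y ≠ 0 :=
    Measure.ae_ae_of_ae_comp ((Measure.rnDeriv_pos hac).mono fun _ h ↦ h.ne')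
  have hae : ∀ᵐ θ ∂q, ∫⁻ y, ENNReal.ofReal (-ℓ y) ∂(κ θ) < ∞ :=
    ae_lt_top hmeas_neg.lintegral_kernel hfin
  have key : EIG κ q + ∫⁻ θ, ∫⁻ y, ENNReal.ofReal (ℓ y) ∂(κ θ) ∂q
      ≤ EIGaff κ q p + ∫⁻ θ, ∫⁻ y, ENNReal.ofReal (-ℓ y) ∂(κ θ) ∂q := by
    rw [EIG, EIGaff, ← lintegral_add_right _ hmeas_pos.lintegral_kernel,
      ← lintegral_add_right _ hmeas_neg.lintegral_kernel]
    refine lintegral_mono_ae ?_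
    filter_upwards [hr, hae] with θ h1 h2
    exact klDiv_add_lintegral_llr_le hac h1 h2.ne
  exact (ENNReal.add_le_add_iff_right hfin).1 ((add_le_add_right hle _).trans key)
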